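/- arXiv:1911.12535 — 3 statements merged into one kernel-verified Lean document; each statement's English description precedes it below -/
import Mathlib

section
/- Assume the vectors n₁, …, n_g span ℝ^k. Let x, x̃ : (−∞, 0] → ℝ^k be differentiable curves taking values in the Weyl chamber C, satisfying x'(t) = F(x(t)) and x̃'(t) = F(x̃(t)), and with ‖x(0)‖ = ‖x̃(0)‖ = 1. Then lim_{t → −∞} ‖x(t) − x̃(t)‖ = 0. -/
open scoped RealInnerProductSpace

/-- The open Weyl chamber determined by the curvature normals `nvec`. -/
def chamber {k g : ℕ} (nvec : Fin g → EuclideanSpace ℝ (Fin k)) :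
    Set (EuclideanSpace ℝ (Fin k)) :=
  {x | ∀ i, ⟪x, nvec i⟫ < 0}

/-- The Euclidean mean curvature flow vector field
`F(x) = −∑ i (m i / ⟨x, nvec i⟩) • nvec i`. -/
noncomputable def mcfField {k g : ℕ} (nvec : Fin g → EuclideanSpace ℝ (Fin k))
    (m : Fin g → ℝ) (x : EuclideanSpace ℝ (Fin k)) : EuclideanSpace ℝ (Fin k) :=
  -∑ i, (m i / ⟪x, nvec i⟫) • nvec i

/-- A positively weighted sum of squared inner products against a spanning family is coercive. -/
lemma exists_pos_mul_norm_sq_le_sum_inner_sq {E ι : Type*} [NormedAddCommGroup E]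
    [InnerProductSpace ℝ E] [FiniteDimensional ℝ E] [Fintype ι] (v : ι → E)
    (hspan : Submodule.span ℝ (Set.range v) = ⊤) (w : ι → ℝ) (hw : ∀ i, 0 < w i) :
    ∃ c > 0, ∀ y : E, c * ‖y‖ ^ 2 ≤ ∑ i, w i * ⟪y, v i⟫ ^ 2 := by
  let T : E →ₗ[ℝ] EuclideanSpace ℝ ι :=
    (WithLp.linearEquiv 2 ℝ (ι → ℝ)).symm.toLinearMap ∘ₗ
      LinearMap.pi fun i => √(w i) • (innerₛₗ ℝ (v i))
  have hT (y : E) (i : ι) : T y i = √(w i) * ⟪y, v i⟫ := by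
    simp [T, real_inner_comm]
  have hinj : LinearMap.ker T = ⊥ := by
    refine (Submodule.eq_bot_iff _).2 fun y hy => ?_
    have hzero : ∀ i, ⟪y, v i⟫ = 0 := fun i => by
      have h := hT y i
      rw [LinearMap.mem_ker.1 hy] at h
      simpa [(Real.sqrt_pos.2 (hw i)).ne'] using h
    have hle : Submodule.span ℝ (Set.range v) ≤ LinearMap.ker (innerₛₗ ℝ y) :=
      Submodule.span_le.2 (by rintro _ ⟨i, rfl⟩; simpa using hzero i)
    rw [hspan] at hle
    simpa using hle (Submodule.mem_top (x := y))
  obtain ⟨K, hK, hanti⟩ := T.exists_antilipschitzWith hinj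
  have hKpos : (0 : ℝ) < K := hK
  refine ⟨((K : ℝ) ^ 2)⁻¹, by positivity, fun y => ?_⟩
  have h : ‖y‖ ≤ K * ‖T y‖ := by simpa using hanti.le_mul_norm_sub y 0
  have hsq : ‖T y‖ ^ 2 = ∑ i, w i * ⟪y, v i⟫ ^ 2 := by
    rw [EuclideanSpace.real_norm_sq_eq]
    exact Finset.sum_congr rfl fun i _ => by rw [hT, mul_pow, Real.sq_sqrt (hw i).le]
  rw [← hsq, inv_mul_le_iff₀ (by positivity), ← mul_pow]
  gcongr

/-- The pairing of a point of the chamber with the mean curvature flow field is constant. -/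
lemma inner_mcfField_self {k g : ℕ} {nvec : Fin g → EuclideanSpace ℝ (Fin k)} (m : Fin g → ℝ)
    {x : EuclideanSpace ℝ (Fin k)} (hx : x ∈ chamber nvec) :
    ⟪x, mcfField nvec m x⟫ = -∑ i, m i := by
  simp only [mcfField, inner_neg_right, inner_sum, inner_smul_right]
  congr 1
  exact Finset.sum_congr rfl fun i _ => div_mul_cancel₀ _ (hx i).ne

/-- The monotonicity pairing of the mean curvature flow field, as a sum of squares. -/
lemma inner_sub_mcfField_sub {k g : ℕ} {nvec : Fin g → EuclideanSpace ℝ (Fin k)} (m : Fin g → ℝ)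
    {x y : EuclideanSpace ℝ (Fin k)} (hx : x ∈ chamber nvec) (hy : y ∈ chamber nvec) :
    ⟪x - y, mcfField nvec m x - mcfField nvec m y⟫ =
      ∑ i, m i * ⟪x - y, nvec i⟫ ^ 2 / (⟪x, nvec i⟫ * ⟪y, nvec i⟫) := by
  simp only [mcfField, inner_sub_right, inner_neg_right, inner_sum, inner_smul_right]
  rw [← Finset.sum_neg_distrib, ← Finset.sum_neg_distrib, ← Finset.sum_sub_distrib]
  refine Finset.sum_congr rfl fun i _ => ?_
  have h₁ := (hx i).ne
  have h₂ := (hy i).ne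
  rw [inner_sub_left]
  field_simp
  ring

lemma monotoneOn_Iic_of_hasDerivAt_nonneg {f f' : ℝ → ℝ} {a : ℝ}
    (hf : ∀ t ≤ a, HasDerivAt f (f' t) t) (hf' : ∀ t ≤ a, 0 ≤ f' t) :
    MonotoneOn f (Set.Iic a) := by
  refine monotoneOn_of_deriv_nonneg (convex_Iic a)
    (fun t ht => (hf t ht).continuousAt.continuousWithinAt) (fun t ht => ?_) fun t ht => ?_
  · exact (hf t (Set.mem_Iic.1 (interior_subset ht))).differentiableAt.differentiableWithinAt
  · have hta : t ≤ a := Set.mem_Iic.1 (interior_subset ht)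
    rw [(hf t hta).deriv]
    exact hf' t hta

/-- Ancient solutions starting on the unit sphere grow at most like the square root of time. -/
lemma norm_sq_le_of_ancient {k g : ℕ} {nvec : Fin g → EuclideanSpace ℝ (Fin k)} {m : Fin g → ℝ}
    {x : ℝ → EuclideanSpace ℝ (Fin k)}
    (hx : ∀ t ≤ (0 : ℝ), x t ∈ chamber nvec ∧ HasDerivAt x (mcfField nvec m (x t)) t)
    (hx0 : ‖x 0‖ = 1) {L : ℝ} (hL : 2 * ∑ i, m i ≤ L) {t : ℝ} (ht : t ≤ 0) :
    ‖x t‖ ^ 2 ≤ 1 - L * t := by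
  have hmono : MonotoneOn (fun s => ‖x s‖ ^ 2 + L * s) (Set.Iic 0) := by
    refine monotoneOn_Iic_of_hasDerivAt_nonneg
      (fun s hs => (hx s hs).2.norm_sq.add ((hasDerivAt_id s).const_mul L)) fun s hs => ?_
    rw [inner_mcfField_self m (hx s hs).1]
    linarith
  have h := hmono (Set.mem_Iic.2 ht) (Set.mem_Iic.2 le_rfl) ht
  simp only [hx0] at h
  linarith

/-- A nonnegative function whose logarithmic derivative is at least `c / (1 - L t)` on `(-∞, 0]`
decays to zero at `-∞`. -/
lemma tendsto_zero_atBot_of_hasDerivAt_ge {u u' : ℝ → ℝ} {c L : ℝ} (hc : 0 < c) (hL : 0 < L)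
    (hu : ∀ t, 0 ≤ u t) (hderiv : ∀ t ≤ 0, HasDerivAt u (u' t) t)
    (hge : ∀ t ≤ 0, c * u t / (1 - L * t) ≤ u' t) :
    Filter.Tendsto u Filter.atBot (nhds 0) := by
  have hpos : ∀ t ≤ (0 : ℝ), 0 < 1 - L * t := fun t ht => by nlinarith
  have hmono : MonotoneOn (fun t => u t * (1 - L * t) ^ (c / L)) (Set.Iic 0) := by
    refine monotoneOn_Iic_of_hasDerivAt_nonneg (fun t ht => (hderiv t ht).mul
      ((((hasDerivAt_id t).const_mul L).const_sub 1).rpow_const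
        (Or.inl (hpos t ht).ne'))) fun t ht => ?_
    have h := hpos t ht
    simp only [id, mul_one]
    rw [Real.rpow_sub_one h.ne']
    have hfactor : u' t * (1 - L * t) ^ (c / L) +
        u t * (-L * (c / L) * ((1 - L * t) ^ (c / L) / (1 - L * t))) =
        (u' t - c * u t / (1 - L * t)) * (1 - L * t) ^ (c / L) := by
      field_simp
      ring
    rw [hfactor]
    exact mul_nonneg (sub_nonneg.2 (hge t ht)) (Real.rpow_nonneg h.le _)
  have htop : Filter.Tendsto (fun t : ℝ => (1 - L * t) ^ (c / L)) Filter.atBot Filter.atTop := by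
    refine (tendsto_rpow_atTop (div_pos hc hL)).comp ?_
    simpa [sub_eq_add_neg] using Filter.tendsto_atTop_add_const_left Filter.atBot (1 : ℝ)
      (Filter.tendsto_neg_atBot_atTop.comp (Filter.tendsto_id.const_mul_atBot hL))
  refine squeeze_zero' (Filter.Eventually.of_forall hu) ?_ (htop.const_div_atTop (u 0))
  filter_upwards [Filter.eventually_le_atBot 0] with t ht
  rw [le_div_iff₀ (Real.rpow_pos_of_pos (hpos t ht) _)]
  simpa using hmono (Set.mem_Iic.2 ht) (Set.mem_Iic.2 le_rfl) ht

/-- Any two ancient solutions of the Euclidean MCF ODE in the Weyl chamber starting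
on the unit sphere are asymptotically equal as `t → −∞`, provided the curvature
normals span `ℝᵏ`. -/
theorem ancient_euclidean_mcf_asymptotic (k g : ℕ)
    (nvec : Fin g → EuclideanSpace ℝ (Fin k)) (hne : ∀ i, nvec i ≠ 0)
    (hspan : Submodule.span ℝ (Set.range nvec) = ⊤)
    (m : Fin g → ℝ) (hm : ∀ i, 0 < m i)
    (x xt : ℝ → EuclideanSpace ℝ (Fin k))
    (hx : ∀ t ≤ (0 : ℝ), x t ∈ chamber nvec ∧ HasDerivAt x (mcfField nvec m (x t)) t)
    (hxt : ∀ t ≤ (0 : ℝ), xt t ∈ chamber nvec ∧ HasDerivAt xt (mcfField nvec m (xt t)) t)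
    (hx0 : ‖x 0‖ = 1) (hxt0 : ‖xt 0‖ = 1) :
    Filter.Tendsto (fun t => ‖x t - xt t‖) Filter.atBot (nhds 0) := by
  have hL : 0 < 2 * ∑ i, m i + 1 := by
    have := Finset.sum_nonneg fun i (_ : i ∈ Finset.univ) => (hm i).le
    linarith
  set L := 2 * ∑ i, m i + 1 with hLdef
  obtain ⟨c, hc, hcoer⟩ := exists_pos_mul_norm_sq_le_sum_inner_sq nvec hspan
    (fun i => m i / ‖nvec i‖ ^ 2)
    fun i => div_pos (hm i) (pow_pos (norm_pos_iff.2 (hne i)) 2)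
  have hlim : Filter.Tendsto (fun t => ‖x t - xt t‖ ^ 2) Filter.atBot (nhds 0) := by
    refine tendsto_zero_atBot_of_hasDerivAt_ge hc hL (fun t => sq_nonneg _)
      (fun t ht => ((hx t ht).2.sub (hxt t ht).2).norm_sq) fun t ht => ?_
    have hR : 0 < 1 - L * t := by nlinarith
    have hxR := norm_sq_le_of_ancient hx hx0 (L := L) (by linarith) ht
    have hxtR := norm_sq_le_of_ancient hxt hxt0 (L := L) (by linarith) ht
    have hsum : c * ‖x t - xt t‖ ^ 2 / (1 - L * t) ≤
        ⟪x t - xt t, mcfField nvec m (x t) - mcfField nvec m (xt t)⟫ := by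
      rw [inner_sub_mcfField_sub m (hx t ht).1 (hxt t ht).1]
      refine (div_le_div_of_nonneg_right (hcoer (x t - xt t)) hR.le).trans ?_
      rw [Finset.sum_div]
      refine Finset.sum_le_sum fun i _ => ?_
      have hprod : 0 < ⟪x t, nvec i⟫ * ⟪xt t, nvec i⟫ :=
        mul_pos_of_neg_of_neg ((hx t ht).1 i) ((hxt t ht).1 i)
      have hbound : ⟪x t, nvec i⟫ * ⟪xt t, nvec i⟫ ≤ ‖nvec i‖ ^ 2 * (1 - L * t) :=
        calc ⟪x t, nvec i⟫ * ⟪xt t, nvec i⟫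
            ≤ |⟪x t, nvec i⟫| * |⟪xt t, nvec i⟫| := by rw [← abs_mul]; exact le_abs_self _
          _ ≤ (‖x t‖ * ‖nvec i‖) * (‖xt t‖ * ‖nvec i‖) := by
            gcongr <;> exact abs_real_inner_le_norm _ _
          _ = ‖nvec i‖ ^ 2 * (‖x t‖ * ‖xt t‖) := by ring
          _ ≤ ‖nvec i‖ ^ 2 * (1 - L * t) := by
            gcongr
            nlinarith [sq_nonneg (‖x t‖ - ‖xt t‖)]
      rw [div_mul_eq_mul_div, div_div]
      exact div_le_div_of_nonneg_left (mul_nonneg (hm i).le (sq_nonneg _)) hprod hbound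
    have hnonneg : 0 ≤ c * ‖x t - xt t‖ ^ 2 / (1 - L * t) := by positivity
    simp only [Pi.sub_apply] at *
    linarith
  simpa using hlim.sqrt
end

section
/- If z₁, z₂ ∈ C satisfy F(z₁) + n·z₁ = 0 and F(z₂) + n·z₂ = 0, then z₁ = z₂. -/
open scoped RealInnerProductSpace

/-- The mean curvature flow vector field is monotone on the Weyl chamber. -/
lemma inner_mcfField_sub_nonneg {k g : ℕ} {nvec : Fin g → EuclideanSpace ℝ (Fin k)}
    {m : Fin g → ℝ} (hm : ∀ i, 0 ≤ m i) {x y : EuclideanSpace ℝ (Fin k)}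
    (hx : x ∈ chamber nvec) (hy : y ∈ chamber nvec) :
    0 ≤ ⟪x - y, mcfField nvec m x - mcfField nvec m y⟫ := by
  have hsub : mcfField nvec m x - mcfField nvec m y =
      ∑ i, (m i / ⟪y, nvec i⟫ - m i / ⟪x, nvec i⟫) • nvec i := by
    simp only [mcfField, sub_smul, Finset.sum_sub_distrib]
    abel
  rw [hsub, inner_sum]
  refine Finset.sum_nonneg fun i _ => ?_
  have hxi : ⟪x, nvec i⟫ < 0 := hx i
  have hyi : ⟪y, nvec i⟫ < 0 := hy i
  rw [inner_smul_right, inner_sub_left]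
  have h : (m i / ⟪y, nvec i⟫ - m i / ⟪x, nvec i⟫) * (⟪x, nvec i⟫ - ⟪y, nvec i⟫) =
      m i * (⟪x, nvec i⟫ - ⟪y, nvec i⟫) ^ 2 / (⟪x, nvec i⟫ * ⟪y, nvec i⟫) := by
    have := hxi.ne
    have := hyi.ne
    field_simp
  rw [h]
  exact div_nonneg (mul_nonneg (hm i) (sq_nonneg _)) (mul_pos_of_neg_of_neg hxi hyi).le

/-- Uniqueness of the stationary point of the spherical MCF in the Weyl chamber:
if `F(z₁) + n·z₁ = 0` and `F(z₂) + n·z₂ = 0` with `z₁, z₂ ∈ C`, then `z₁ = z₂`. -/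
theorem stationary_point_unique (k g : ℕ) (hg : 0 < g)
    (nvec : Fin g → EuclideanSpace ℝ (Fin k)) (hne : ∀ i, nvec i ≠ 0)
    (m : Fin g → ℝ) (hm : ∀ i, 0 < m i)
    (z₁ z₂ : EuclideanSpace ℝ (Fin k))
    (hz₁ : z₁ ∈ chamber nvec) (hz₂ : z₂ ∈ chamber nvec)
    (h₁ : mcfField nvec m z₁ + (∑ i, m i) • z₁ = 0)
    (h₂ : mcfField nvec m z₂ + (∑ i, m i) • z₂ = 0) :
    z₁ = z₂ := by
  have hpos : 0 < ∑ i, m i :=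
    Finset.sum_pos (fun i _ => hm i) ⟨⟨0, hg⟩, Finset.mem_univ _⟩
  have hmono := inner_mcfField_sub_nonneg (fun i => (hm i).le) hz₁ hz₂
  have hsub : mcfField nvec m z₁ - mcfField nvec m z₂ = -((∑ i, m i) • (z₁ - z₂)) := by
    rw [eq_neg_of_add_eq_zero_left h₁, eq_neg_of_add_eq_zero_left h₂, smul_sub]
    abel
  rw [hsub, inner_neg_right, inner_smul_right, real_inner_self_eq_norm_sq] at hmono
  have hnorm : ‖z₁ - z₂‖ ^ 2 = 0 := by
    nlinarith [sq_nonneg ‖z₁ - z₂‖]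
  exact sub_eq_zero.mp (norm_eq_zero.mp (pow_eq_zero_iff two_ne_zero |>.mp hnorm))
end

section
/- Suppose g ≥ 2. Let θ : (−∞, 0] → (0, π/g) be a differentiable function satisfying θ'(t) = −n·(cot(gθ(t)) + δ·csc(gθ(t))) with θ(0) = θ₀ ≠ θ_min. Then there exist t₁ > 0 and constants c₁ ≥ c₂ > 0 such that for all t < −t₁: H2(θ(t)) > 0 and c₂·e^{−2gnt} ≤ A2(θ(t))/H2(θ(t)) ≤ c₁·e^{−2gnt}. -/
open Real

/-- `n = g(m₁+m₂)/2`, the dimension of the isoparametric hypersurface. -/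
noncomputable def nn (g m₁ m₂ : ℕ) : ℝ := (g : ℝ) * ((m₁ : ℝ) + (m₂ : ℝ)) / 2

/-- `δ = (m₂ − m₁)/(m₁ + m₂)`. -/
noncomputable def dlt (m₁ m₂ : ℕ) : ℝ := ((m₂ : ℝ) - (m₁ : ℝ)) / ((m₁ : ℝ) + (m₂ : ℝ))

/-- The right-hand side of the spherical MCF ODE: `−n(cot gθ + δ csc gθ)`. -/
noncomputable def sphODE (g m₁ m₂ : ℕ) (θ : ℝ) : ℝ :=
  -(nn g m₁ m₂) * (Real.cos ((g : ℝ) * θ) / Real.sin ((g : ℝ) * θ)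
    + dlt m₁ m₂ * (1 / Real.sin ((g : ℝ) * θ)))

/-- `A2(θ) = ng(1 + δ cos gθ)/sin²(gθ) − n`, the squared norm of the spherical shape
operator of the isoparametric hypersurface at angle `θ`. -/
noncomputable def A2 (g m₁ m₂ : ℕ) (θ : ℝ) : ℝ :=
  nn g m₁ m₂ * (g : ℝ) * (1 + dlt m₁ m₂ * Real.cos ((g : ℝ) * θ)) /
    (Real.sin ((g : ℝ) * θ)) ^ 2 - nn g m₁ m₂

/-- `H2(θ) = n²(cos gθ + δ)²/sin²(gθ)`, the squared norm of the spherical mean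
curvature of the isoparametric hypersurface at angle `θ`. -/
noncomputable def H2 (g m₁ m₂ : ℕ) (θ : ℝ) : ℝ :=
  (nn g m₁ m₂) ^ 2 * (Real.cos ((g : ℝ) * θ) + dlt m₁ m₂) ^ 2 /
    (Real.sin ((g : ℝ) * θ)) ^ 2

theorem dlt_sq_lt_one {m₁ m₂ : ℕ} (hm₁ : 0 < m₁) (hm₂ : 0 < m₂) : dlt m₁ m₂ ^ 2 < 1 := by
  have h₁ : (0 : ℝ) < m₁ := by exact_mod_cast hm₁
  have h₂ : (0 : ℝ) < m₂ := by exact_mod_cast hm₂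
  rw [dlt, div_pow, div_lt_one (by positivity)]
  nlinarith [mul_pos h₁ h₂]

theorem nn_pos {g m₁ m₂ : ℕ} (hg : 0 < g) (hm₁ : 0 < m₁) : 0 < nn g m₁ m₂ := by
  have h₀ : (0 : ℝ) < g := by exact_mod_cast hg
  have h₁ : (0 : ℝ) < m₁ := by exact_mod_cast hm₁
  unfold nn
  positivity

theorem mul_mem_Ioo_zero_pi {g : ℕ} (hg : 0 < g) {x : ℝ} (hx : x ∈ Set.Ioo 0 (π / (g : ℝ))) :
    (g : ℝ) * x ∈ Set.Ioo 0 π := by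
  have h₀ : (0 : ℝ) < g := by exact_mod_cast hg
  refine ⟨mul_pos h₀ hx.1, ?_⟩
  have h := (lt_div_iff₀ h₀).1 hx.2
  linarith

/-- Solutions of the linear equation `u' = k u` on `(-∞, 0]` are exponentials. -/
theorem eq_mul_exp_of_hasDerivAt {u : ℝ → ℝ} {k : ℝ}
    (hu : ∀ t ≤ (0 : ℝ), HasDerivAt u (k * u t) t) {t : ℝ} (ht : t ≤ 0) :
    u t = u 0 * exp (k * t) := by
  have hw : ∀ s ≤ (0 : ℝ), HasDerivAt (fun s => u s * exp (-(k * s))) 0 s := by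
    intro s hs
    have he : HasDerivAt (fun s => exp (-(k * s))) (exp (-(k * s)) * -(k * 1)) s :=
      (((hasDerivAt_id s).const_mul k).neg).exp
    exact ((hu s hs).mul he).congr_deriv (by ring)
  have h := constant_of_has_deriv_right_zero (a := t) (b := 0)
    (fun s hs => (hw s hs.2).continuousAt.continuousWithinAt)
    (fun s hs => (hw s hs.2.le).hasDerivWithinAt) 0 ⟨ht, le_rfl⟩
  simp only [mul_zero, neg_zero, exp_zero, mul_one] at h
  rw [h, mul_assoc, ← exp_add, neg_add_cancel, exp_zero, mul_one]

/-- Along the flow, `cos gθ + δ` solves a linear equation. -/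
theorem hasDerivAt_cos_add_dlt {g m₁ m₂ : ℕ} {θ : ℝ → ℝ} {t : ℝ}
    (hs : sin ((g : ℝ) * θ t) ≠ 0) (hθ : HasDerivAt θ (sphODE g m₁ m₂ (θ t)) t) :
    HasDerivAt (fun t => cos ((g : ℝ) * θ t) + dlt m₁ m₂)
      ((g : ℝ) * nn g m₁ m₂ * (cos ((g : ℝ) * θ t) + dlt m₁ m₂)) t := by
  refine ((hθ.const_mul (g : ℝ)).cos.add_const (dlt m₁ m₂)).congr_deriv ?_
  unfold sphODE
  field_simp

theorem A2_div_H2 {g m₁ m₂ : ℕ} {x : ℝ} (hs : sin ((g : ℝ) * x) ≠ 0) (hn : nn g m₁ m₂ ≠ 0) :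
    A2 g m₁ m₂ x / H2 g m₁ m₂ x =
      ((g : ℝ) * (1 + dlt m₁ m₂ * cos ((g : ℝ) * x)) - sin ((g : ℝ) * x) ^ 2) /
        (nn g m₁ m₂ * (cos ((g : ℝ) * x) + dlt m₁ m₂) ^ 2) := by
  unfold A2 H2
  rcases eq_or_ne (cos ((g : ℝ) * x) + dlt m₁ m₂) 0 with hu | hu
  · simp [hu]
  · field_simp

theorem one_sub_sq_le_and_le_two_mul {g d x : ℝ} (hg : 2 ≤ g) (hd : d ^ 2 < 1)
    (hx : x ^ 2 ≤ 1) :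
    1 - d ^ 2 ≤ g * (1 + d * x) - (1 - x ^ 2) ∧ g * (1 + d * x) - (1 - x ^ 2) ≤ 2 * g := by
  have h₁ : 0 ≤ 1 + d * x := by nlinarith [sq_nonneg (d + x)]
  have h₂ : d * x ≤ 1 := by nlinarith [sq_nonneg (d - x)]
  constructor
  · nlinarith [mul_nonneg (sub_nonneg.2 hg) h₁, sq_nonneg (d + x)]
  · nlinarith [mul_nonneg (by linarith : 0 ≤ g) (sub_nonneg.2 h₂)]

/-- Corollary 4.11(2): for `g ≥ 2`, along a non-stationary ancient spherical MCF of
isoparametric hypersurfaces there are `t₁ > 0` and constants `c₁ ≥ c₂ > 0` with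
`c₂ e^{−2gnt} ≤ ‖A(t)‖²/‖H(t)‖² ≤ c₁ e^{−2gnt}` for all `t < −t₁`. -/
theorem ancient_A_over_H_estimate (g m₁ m₂ : ℕ) (hg : 2 ≤ g)
    (hm₁ : 0 < m₁) (hm₂ : 0 < m₂) (hodd : Odd g → m₁ = m₂)
    (θmin : ℝ) (hθmin : θmin ∈ Set.Ioo 0 (π / (g : ℝ)))
    (hmin : Real.cos ((g : ℝ) * θmin) = -dlt m₁ m₂)
    (θ : ℝ → ℝ)
    (hθ : ∀ t ≤ (0 : ℝ), θ t ∈ Set.Ioo 0 (π / (g : ℝ)) ∧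
      HasDerivAt θ (sphODE g m₁ m₂ (θ t)) t)
    (hne : θ 0 ≠ θmin) :
    ∃ t₁ > (0 : ℝ), ∃ c₁ > (0 : ℝ), ∃ c₂ > (0 : ℝ), c₂ ≤ c₁ ∧
      ∀ t < -t₁,
        0 < H2 g m₁ m₂ (θ t) ∧
        c₂ * Real.exp (-(2 * (g : ℝ) * nn g m₁ m₂ * t))
          ≤ A2 g m₁ m₂ (θ t) / H2 g m₁ m₂ (θ t) ∧
        A2 g m₁ m₂ (θ t) / H2 g m₁ m₂ (θ t)
          ≤ c₁ * Real.exp (-(2 * (g : ℝ) * nn g m₁ m₂ * t)) := by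
  have hg0 : 0 < g := by omega
  have hgR : (2 : ℝ) ≤ g := by exact_mod_cast hg
  have hn : 0 < nn g m₁ m₂ := nn_pos hg0 hm₁
  have hd := dlt_sq_lt_one hm₁ hm₂
  have hsin : ∀ t ≤ (0 : ℝ), 0 < sin ((g : ℝ) * θ t) := fun t ht =>
    sin_pos_of_mem_Ioo (mul_mem_Ioo_zero_pi hg0 (hθ t ht).1)
  set u₀ : ℝ := cos ((g : ℝ) * θ 0) + dlt m₁ m₂ with hu₀_def
  have hu₀ : u₀ ≠ 0 := by
    intro h
    have hcos : cos ((g : ℝ) * θ 0) = cos ((g : ℝ) * θmin) := by rw [hmin]; linarith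
    have := injOn_cos (Set.Ioo_subset_Icc_self (mul_mem_Ioo_zero_pi hg0 (hθ 0 le_rfl).1))
      (Set.Ioo_subset_Icc_self (mul_mem_Ioo_zero_pi hg0 hθmin)) hcos
    exact hne (mul_left_cancel₀ (by positivity) this)
  have hden : 0 < nn g m₁ m₂ * u₀ ^ 2 := by positivity
  refine ⟨1, one_pos, 2 * g / (nn g m₁ m₂ * u₀ ^ 2), by positivity,
    (1 - dlt m₁ m₂ ^ 2) / (nn g m₁ m₂ * u₀ ^ 2), div_pos (by linarith) hden, ?_, ?_⟩
  · gcongr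
    nlinarith [sq_nonneg (dlt m₁ m₂)]
  intro t ht
  have ht0 : t ≤ 0 := by linarith
  have hs := hsin t ht0
  have hu : cos ((g : ℝ) * θ t) + dlt m₁ m₂ = u₀ * exp (g * nn g m₁ m₂ * t) :=
    eq_mul_exp_of_hasDerivAt (u := fun t => cos ((g : ℝ) * θ t) + dlt m₁ m₂)
      (fun s hs => hasDerivAt_cos_add_dlt (hsin s hs).ne' (hθ s hs).2) ht0
  have hratio : A2 g m₁ m₂ (θ t) / H2 g m₁ m₂ (θ t) =
      ((g : ℝ) * (1 + dlt m₁ m₂ * cos ((g : ℝ) * θ t)) - (1 - cos ((g : ℝ) * θ t) ^ 2)) /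
        (nn g m₁ m₂ * u₀ ^ 2) * exp (-(2 * (g : ℝ) * nn g m₁ m₂ * t)) := by
    have he : exp (-(2 * (g : ℝ) * nn g m₁ m₂ * t)) = (exp (g * nn g m₁ m₂ * t) ^ 2)⁻¹ := by
      rw [exp_neg, ← exp_nat_mul]
      congr 2
      push_cast
      ring
    rw [A2_div_H2 hs.ne' hn.ne', hu, he, sin_sq]
    field_simp
  obtain ⟨hlow, hupp⟩ := one_sub_sq_le_and_le_two_mul hgR hd (cos_sq_le_one ((g : ℝ) * θ t))
  refine ⟨?_, ?_, ?_⟩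
  · rw [H2, hu]
    positivity
  · rw [hratio]
    gcongr
  · rw [hratio]
    gcongr
end
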